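/- arXiv:1604.00663 — 2 statements merged into one kernel-verified Lean document; each statement's English description precedes it below -/
import Mathlib

section
/- For every n ≥ 1, the sixth central moment of the Gepner statistic over W(n,n,n) equals n⁹(279n³ − 656n² + 512n − 128)/448; that is, (1/|W(n,n,n)|) Σ_{w ∈ W(n,n,n)} (gep(w) − n³/2)⁶ = n⁹(279n³ − 656n² + 512n − 128)/448 (as an identity in ℚ). -/
/-- The Gepner statistic of a word `w` over a totally ordered alphabet:
the number of triples of positions `i < j < k` such that `w_i w_j w_k`
reduces to one of the odd permutations `132`, `213`, `321`. -/
def gep {α : Type*} [LinearOrder α] (w : List α) : ℕ :=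
  (Finset.univ.filter (fun t : Fin w.length × Fin w.length × Fin w.length =>
    t.1 < t.2.1 ∧ t.2.1 < t.2.2 ∧
      ((w.get t.1 < w.get t.2.2 ∧ w.get t.2.2 < w.get t.2.1) ∨
       (w.get t.2.1 < w.get t.1 ∧ w.get t.1 < w.get t.2.2) ∨
       (w.get t.2.2 < w.get t.2.1 ∧ w.get t.2.1 < w.get t.1)))).card

/-- `W a1 a2 a3` is the (finite) set of words over the alphabet `{1,2,3}`
with exactly `a1` occurrences of `1`, `a2` occurrences of `2` and
`a3` occurrences of `3`. -/
def W (a1 a2 a3 : ℕ) : Finset (List ℕ) :=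
  ((List.replicate a1 1 ++ List.replicate a2 2 ++ List.replicate a3 3).permutations).toFinset

namespace GepAux

/-- Number of pairs of positions `i < j` with letters `x`, `y`. -/
def pr (x y : ℕ) : List ℕ → ℕ
  | [] => 0
  | z :: u => (if z = x then u.count y else 0) + pr x y u

/-- Recursive version of `gep` on words over `{1,2,3}`. -/
def G : List ℕ → ℕ
  | [] => 0
  | z :: u => (if z = 1 then pr 3 2 u else if z = 2 then pr 1 3 u else pr 2 1 u) + G u

/-- The quadratic statistic (algebraic area). -/
def Y (w : List ℕ) : ℚ :=
  (w.count 1 : ℚ) * w.count 2 + w.count 2 * w.count 3 + w.count 3 * w.count 1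
    - 2 * ((pr 2 1 w : ℚ) + pr 3 2 w + pr 1 3 w)

theorem Y_one (u : List ℕ) : Y (1 :: u) = Y u + (u.count 2 - u.count 3) := by
  simp [Y, pr]; ring

theorem Y_two (u : List ℕ) : Y (2 :: u) = Y u + (u.count 3 - u.count 1) := by
  simp [Y, pr]; ring

theorem Y_three (u : List ℕ) : Y (3 :: u) = Y u + (u.count 1 - u.count 2) := by
  simp [Y, pr]; ring

theorem G_eq (w : List ℕ) (hw : ∀ x ∈ w, x = 1 ∨ x = 2 ∨ x = 3) :
    (G w : ℚ) = w.count 3 * pr 2 1 w + w.count 1 * pr 3 2 w + w.count 2 * pr 1 3 w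
      - w.count 1 * w.count 2 * w.count 3 := by
  induction w with
  | nil => simp [G, pr]
  | cons z u ih =>
    have ih := ih (fun x hx => hw x (List.mem_cons_of_mem _ hx))
    rcases hw z (by simp) with rfl | rfl | rfl <;> simp [G, pr, ih] <;> ring

/-- `pr` as a sum over positions. -/
theorem pr_sum (x y : ℕ) (w : List ℕ) :
    pr x y w = ∑ i : Fin w.length, ∑ j : Fin w.length,
      if i < j ∧ w.get i = x ∧ w.get j = y then 1 else 0 := by
  induction w with
  | nil => simp [pr]
  | cons z u ih =>
    have hc : ∀ v : List ℕ, v.count y = ∑ j : Fin v.length, if v.get j = y then 1 else 0 := by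
      intro v
      induction v with
      | nil => simp
      | cons t v ih =>
        rw [List.count_cons, ih]
        simp only [List.length_cons]
        rw [Fin.sum_univ_succ]
        rw [add_comm]
        congr 1
        by_cases h : t = y <;> simp [h]
    simp only [List.length_cons]
    rw [pr, ih, Fin.sum_univ_succ, Fin.sum_univ_succ]
    congr 1
    · by_cases h : z = x
      · rw [hc]; simp [h, -Finset.sum_boole]
      · simp [h]
    · apply Finset.sum_congr rfl
      intro i _
      rw [Fin.sum_univ_succ]
      simp

/-- The pattern condition. -/
def bad (p q r : ℕ) : Prop := (p < r ∧ r < q) ∨ (q < p ∧ p < r) ∨ (r < q ∧ q < p)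

instance (p q r : ℕ) : Decidable (bad p q r) := by unfold bad; infer_instance

theorem gep_sum (w : List ℕ) :
    gep w = ∑ i : Fin w.length, ∑ j : Fin w.length, ∑ k : Fin w.length,
      if i < j ∧ j < k ∧ bad (w.get i) (w.get j) (w.get k) then 1 else 0 := by
  unfold gep
  rw [Finset.card_filter, Fintype.sum_prod_type]
  apply Finset.sum_congr rfl
  intro i _
  rw [Fintype.sum_prod_type]
  rfl

theorem gep_cons (z : ℕ) (u : List ℕ) :
    gep (z :: u) = (∑ j : Fin u.length, ∑ k : Fin u.length,
      if j < k ∧ bad z (u.get j) (u.get k) then 1 else 0) + gep u := by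
  rw [gep_sum, gep_sum]
  simp only [List.length_cons]
  rw [Fin.sum_univ_succ]
  congr 1
  · rw [Fin.sum_univ_succ]
    simp only [Fin.sum_univ_succ (n := u.length)]
    simp [-Finset.sum_boole]
  · apply Finset.sum_congr rfl
    intro i _
    rw [Fin.sum_univ_succ]
    simp only [Fin.sum_univ_succ (n := u.length)]
    simp [-Finset.sum_boole]

theorem gep_eq_G (w : List ℕ) (hw : ∀ x ∈ w, x = 1 ∨ x = 2 ∨ x = 3) : gep w = G w := by
  induction w with
  | nil => simp [G, gep_sum]
  | cons z u ih =>
    have hu : ∀ x ∈ u, x = 1 ∨ x = 2 ∨ x = 3 := fun x hx => hw x (List.mem_cons_of_mem _ hx)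
    rw [gep_cons, ih hu, G]
    congr 1
    have key : ∀ x y : ℕ, (∀ p q : ℕ, (p = 1 ∨ p = 2 ∨ p = 3) → (q = 1 ∨ q = 2 ∨ q = 3) →
        (bad z p q ↔ p = x ∧ q = y)) →
        (∑ j : Fin u.length, ∑ k : Fin u.length,
          if j < k ∧ bad z (u.get j) (u.get k) then 1 else 0) = pr x y u := by
      intro x y h
      rw [pr_sum]
      refine Finset.sum_congr rfl fun j _ => Finset.sum_congr rfl fun k _ => ?_
      have := h (u.get j) (u.get k) (hu _ (List.get_mem _ _)) (hu _ (List.get_mem _ _))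
      simp only [this]
    rcases hw z (by simp) with rfl | rfl | rfl
    · rw [key 3 2 (by unfold bad; omega)]; simp
    · rw [key 1 3 (by unfold bad; omega)]; simp
    · rw [key 2 1 (by unfold bad; omega)]; simp

theorem mem_W (a b c : ℕ) (w : List ℕ) : w ∈ W a b c ↔
    w.count 1 = a ∧ w.count 2 = b ∧ w.count 3 = c ∧ ∀ x ∈ w, x = 1 ∨ x = 2 ∨ x = 3 := by
  unfold W
  rw [List.mem_toFinset, List.mem_permutations]
  constructor
  · intro h
    refine ⟨?_, ?_, ?_, ?_⟩
    · rw [h.count_eq]; simp [List.count_replicate]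
    · rw [h.count_eq]; simp [List.count_replicate]
    · rw [h.count_eq]; simp [List.count_replicate]
    · intro x hx
      have := h.subset hx
      simp only [List.mem_append, List.mem_replicate] at this
      tauto
  · rintro ⟨h1, h2, h3, h⟩
    rw [List.perm_iff_count]
    intro x
    by_cases hx : x ∈ w
    · rcases h x hx with rfl | rfl | rfl <;> simp [List.count_replicate, *]
    · have h0 := List.count_eq_zero_of_not_mem hx
      have e1 : x = 1 → a = 0 := by rintro rfl; omega
      have e2 : x = 2 → b = 0 := by rintro rfl; omega
      have e3 : x = 3 → c = 0 := by rintro rfl; omega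
      simp only [h0, List.count_append, List.count_replicate, beq_iff_eq]
      split_ifs <;> omega

/-- Words of the given content starting with a fixed letter. -/
def T1 (f : List ℕ → ℚ) (a b c : ℕ) : ℚ :=
  if a = 0 then 0 else ∑ u ∈ W (a - 1) b c, f (1 :: u)

/-- Words starting with 2. -/
def T2 (f : List ℕ → ℚ) (a b c : ℕ) : ℚ :=
  if b = 0 then 0 else ∑ u ∈ W a (b - 1) c, f (2 :: u)

/-- Words starting with 3. -/
def T3 (f : List ℕ → ℚ) (a b c : ℕ) : ℚ :=
  if c = 0 then 0 else ∑ u ∈ W a b (c - 1), f (3 :: u)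

theorem head_sum (f : List ℕ → ℚ) (S Tl : Finset (List ℕ)) (x : ℕ)
    (h : ∀ u, x :: u ∈ S ↔ u ∈ Tl) :
    (∑ w ∈ S with w.head? = some x, f w) = ∑ u ∈ Tl, f (x :: u) := by
  symm
  refine Finset.sum_bij (fun u _ => x :: u) ?_ ?_ ?_ ?_
  · intro u hu; simp [h, hu]
  · intro u _ v _ huv; simpa using huv
  · intro w hw
    rw [Finset.mem_filter] at hw
    obtain ⟨hw, hh⟩ := hw
    cases w with
    | nil => simp at hh
    | cons z u =>
      simp only [List.head?_cons, Option.some.injEq] at hh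
      subst hh
      exact ⟨u, (h u).1 hw, rfl⟩
  · intro _ _; rfl

theorem W_sum (f : List ℕ → ℚ) (a b c : ℕ) (hs : 0 < a + b + c) :
    ∑ w ∈ W a b c, f w = T1 f a b c + T2 f a b c + T3 f a b c := by
  have split : ∑ w ∈ W a b c, f w =
      (∑ w ∈ W a b c with w.head? = some 1, f w) + (∑ w ∈ W a b c with w.head? = some 2, f w)
        + (∑ w ∈ W a b c with w.head? = some 3, f w) := by
    simp only [Finset.sum_filter]
    rw [← Finset.sum_add_distrib, ← Finset.sum_add_distrib]
    refine Finset.sum_congr rfl fun w hw => ?_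
    rw [mem_W] at hw
    obtain ⟨h1, h2, h3, h⟩ := hw
    cases w with
    | nil => simp at h1 h2 h3; omega
    | cons z u => rcases h z (by simp) with rfl | rfl | rfl <;> simp
  rw [split]
  congr 1
  · congr 1
    · unfold T1
      split_ifs with h0
      · rw [head_sum f _ ∅ 1]
        · simp
        · intro u; simp [mem_W, h0]
      · apply head_sum
        intro u
        simp only [mem_W, List.count_cons, List.mem_cons, forall_eq_or_imp]
        simp
        intros
        omega
    · unfold T2
      split_ifs with h0
      · rw [head_sum f _ ∅ 2]
        · simp
        · intro u; simp [mem_W, h0]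
      · apply head_sum
        intro u
        simp only [mem_W, List.count_cons, List.mem_cons, forall_eq_or_imp]
        simp
        intros
        omega
  · unfold T3
    split_ifs with h0
    · rw [head_sum f _ ∅ 3]
      · simp
      · intro u; simp [mem_W, h0]
    · apply head_sum
      intro u
      simp only [mem_W, List.count_cons, List.mem_cons, forall_eq_or_imp]
      simp
      intros
      omega

/-- Second moment in terms of elementary symmetric functions. -/
def P2 (x y z : ℚ) : ℚ :=
    (1/3)*y
    + (1/3)*x*y
    + (-3)*z

/-- Fourth moment. -/
def P4 (x y z : ℚ) : ℚ :=
    (-2/15)*x*y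
    + (-4/15)*x^2*y
    + (-2/15)*x^3*y
    + (7/15)*y^2
    + (4/5)*x*y^2
    + (1/3)*x^2*y^2
    + (-2)*z
    + (12/5)*x*z
    + (22/5)*x^2*z
    + (-84/5)*y*z
    + (-6)*x*y*z
    + (27)*z^2

/-- Sixth moment. -/
def P6 (x y z : ℚ) : ℚ :=
    (-8/63)*x*y
    + (40/63)*x^3*y
    + (16/21)*x^4*y
    + (16/63)*x^5*y
    + (-82/63)*x*y^2
    + (-22/7)*x^2*y^2
    + (-158/63)*x^3*y^2
    + (-2/3)*x^4*y^2
    + (31/21)*y^3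
    + (205/63)*x*y^3
    + (7/3)*x^2*y^3
    + (5/9)*x^3*y^3
    + (-120/7)*z
    + (512/21)*x*z
    + (232/9)*x^2*z
    + (-240/7)*x^3*z
    + (-1168/63)*x^4*z
    + (-114)*y*z
    + (104)*x*y*z
    + (1074/7)*x^2*y*z
    + (28)*x^3*y*z
    + (-1821/7)*y^2*z
    + (-90)*x*y^2*z
    + (-15)*x^2*y^2*z
    + (414/7)*z^2
    + (-324/7)*x*z^2
    + (-198)*x^2*z^2
    + (621)*y*z^2
    + (135)*x*y*z^2
    + (-405)*z^3

/-- Normalised moments of `Y`. -/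
def P (r : ℕ) (a b c : ℚ) : ℚ :=
  match r with
  | 0 => 1
  | 2 => P2 (a + b + c) (a * b + b * c + c * a) (a * b * c)
  | 4 => P4 (a + b + c) (a * b + b * c + c * a) (a * b * c)
  | 6 => P6 (a + b + c) (a * b + b * c + c * a) (a * b * c)
  | _ => 0

/-- Moment after a shift by `d`. -/
def Sh (r : ℕ) (d a b c : ℚ) : ℚ :=
  ∑ j ∈ Finset.range (r + 1), P j a b c * d ^ (r - j) * (r.choose j : ℚ)

theorem P_rec (r : ℕ) (hr : r ≤ 6) (a b c : ℚ) :
    a * Sh r (b - c) (a - 1) b c + b * Sh r (c - a) a (b - 1) c + c * Sh r (a - b) a b (c - 1)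
      = (a + b + c) * P r a b c := by
  interval_cases r <;>
    simp only [Sh, Finset.sum_range_succ, Finset.sum_range_zero, P, P2, P4, P6] <;>
    norm_num [Nat.choose] <;> ring

theorem P_zero (r : ℕ) (hr : r ≤ 6) : P r 0 0 0 = (0 : ℚ) ^ r := by
  interval_cases r <;> simp [P, P2, P4, P6]

theorem shift_sum (S : Finset (List ℕ)) (x r : ℕ) (d K a b c : ℚ)
    (hY : ∀ u ∈ S, Y (x :: u) = Y u + d)
    (h : ∀ j ≤ r, ∑ u ∈ S, Y u ^ j = K * P j a b c) :
    ∑ u ∈ S, Y (x :: u) ^ r = K * Sh r d a b c := by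
  have : ∑ u ∈ S, Y (x :: u) ^ r = ∑ u ∈ S, ∑ j ∈ Finset.range (r + 1),
      Y u ^ j * d ^ (r - j) * (r.choose j : ℚ) := by
    refine Finset.sum_congr rfl fun u hu => ?_
    rw [hY u hu, add_pow]
  rw [this, Finset.sum_comm, Sh, Finset.mul_sum]
  refine Finset.sum_congr rfl fun j hj => ?_
  rw [← Finset.sum_mul, ← Finset.sum_mul, h j (by rw [Finset.mem_range] at hj; omega)]
  ring

/-- Multinomial coefficient. -/
def N (a b c : ℕ) : ℚ := ((a + b + c).factorial : ℚ) / (a.factorial * b.factorial * c.factorial)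

theorem N_one (a b c : ℕ) : N a b c * (a + 1) * (b + c + a + 1) = N (a + 1) b c * (a + 1) ^ 2 := by
  have h : a + 1 + b + c = (a + b + c) + 1 := by ring
  unfold N
  rw [h, Nat.factorial_succ, Nat.factorial_succ]
  have h1 := Nat.cast_ne_zero (R := ℚ).2 (Nat.factorial_ne_zero a)
  have h2 := Nat.cast_ne_zero (R := ℚ).2 (Nat.factorial_ne_zero b)
  have h3 := Nat.cast_ne_zero (R := ℚ).2 (Nat.factorial_ne_zero c)
  have h4 : (a : ℚ) + 1 ≠ 0 := by positivity
  push_cast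
  field_simp
  ring

theorem N_swap (a b c : ℕ) : N a b c = N b a c := by
  unfold N
  rw [show a + b + c = b + a + c by ring, mul_comm (a.factorial : ℚ)]

theorem N_rot (a b c : ℕ) : N a b c = N c a b := by
  unfold N
  rw [show a + b + c = c + a + b by ring]
  ring

theorem moments (s : ℕ) : ∀ a b c : ℕ, a + b + c = s → ∀ r ≤ 6,
    ∑ w ∈ W a b c, Y w ^ r = N a b c * P r a b c := by
  induction s with
  | zero =>
    intro a b c hs r hr
    obtain ⟨rfl, rfl, rfl⟩ : a = 0 ∧ b = 0 ∧ c = 0 := by omega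
    have hW : W 0 0 0 = {[]} := by simp [W]
    rw [hW, Finset.sum_singleton]
    simp only [Nat.cast_zero]
    rw [P_zero r hr]
    simp [Y, pr, N]
  | succ s ih =>
    intro a b c hs r hr
    have hsq : (a : ℚ) + b + c = s + 1 := by exact_mod_cast hs
    have hs0 : (a : ℚ) + b + c ≠ 0 := by rw [hsq]; positivity
    rw [W_sum _ _ _ _ (by omega)]
    have t1 : (a + b + c : ℚ) * T1 (fun w => Y w ^ r) a b c
        = N a b c * (a * Sh r (b - c) (a - 1) b c) := by
      unfold T1
      cases a with
      | zero => simp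
      | succ a =>
        simp only [Nat.add_sub_cancel, Nat.succ_ne_zero, if_false]
        rw [shift_sum (W a b c) 1 r (b - c) (N a b c) a b c]
        · have := N_one a b c
          have h4 : (a : ℚ) + 1 ≠ 0 := by positivity
          have h5 : N a b c * (b + c + a + 1) = N (a + 1) b c * (a + 1) := by
            apply mul_left_cancel₀ h4; linarith
          push_cast
          rw [add_sub_cancel_right]
          linear_combination Sh r (b - c) a b c * h5
        · intro u hu
          rw [mem_W] at hu
          rw [Y_one, hu.2.1, hu.2.2.1]
        · intro j hj
          exact ih a b c (by omega) j (by omega)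
    have t2 : (a + b + c : ℚ) * T2 (fun w => Y w ^ r) a b c
        = N a b c * (b * Sh r (c - a) a (b - 1) c) := by
      unfold T2
      cases b with
      | zero => simp
      | succ b =>
        simp only [Nat.add_sub_cancel, Nat.succ_ne_zero, if_false]
        rw [shift_sum (W a b c) 2 r (c - a) (N a b c) a b c]
        · have := N_one b a c
          rw [N_swap b a c, N_swap (b + 1) a c] at this
          have h4 : (b : ℚ) + 1 ≠ 0 := by positivity
          have h5 : N a b c * (a + c + b + 1) = N a (b + 1) c * (b + 1) := by
            apply mul_left_cancel₀ h4; linarith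
          push_cast
          rw [add_sub_cancel_right]
          linear_combination Sh r (c - a) a b c * h5
        · intro u hu
          rw [mem_W] at hu
          rw [Y_two, hu.1, hu.2.2.1]
        · intro j hj
          exact ih a b c (by omega) j (by omega)
    have t3 : (a + b + c : ℚ) * T3 (fun w => Y w ^ r) a b c
        = N a b c * (c * Sh r (a - b) a b (c - 1)) := by
      unfold T3
      cases c with
      | zero => simp
      | succ c =>
        simp only [Nat.add_sub_cancel, Nat.succ_ne_zero, if_false]
        rw [shift_sum (W a b c) 3 r (a - b) (N a b c) a b c]
        · have := N_one c a b
          rw [← N_rot a b c, ← N_rot a b (c + 1)] at this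
          have h4 : (c : ℚ) + 1 ≠ 0 := by positivity
          have h5 : N a b c * (a + b + c + 1) = N a b (c + 1) * (c + 1) := by
            apply mul_left_cancel₀ h4; linarith
          push_cast
          rw [add_sub_cancel_right]
          linear_combination Sh r (a - b) a b c * h5
        · intro u hu
          rw [mem_W] at hu
          rw [Y_three, hu.1, hu.2.1]
        · intro j hj
          exact ih a b c (by omega) j (by omega)
    apply mul_left_cancel₀ hs0
    have := P_rec r hr a b c
    linear_combination t1 + t2 + t3 + N a b c * this

theorem gep_Y (n : ℕ) (w : List ℕ) (hw : w ∈ W n n n) :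
    (gep w : ℚ) - (n : ℚ) ^ 3 / 2 = - (n / 2) * Y w := by
  rw [mem_W] at hw
  obtain ⟨h1, h2, h3, h⟩ := hw
  rw [gep_eq_G w h, G_eq w h, Y, h1, h2, h3]
  ring

end GepAux

theorem gep_words_sixth_central_moment (n : ℕ) (hn : 1 ≤ n) :
    (∑ w ∈ W n n n, ((gep w : ℚ) - (n : ℚ) ^ 3 / 2) ^ 6) / ((W n n n).card : ℚ) =
      (n : ℚ) ^ 9 * (279 * (n : ℚ) ^ 3 - 656 * (n : ℚ) ^ 2 + 512 * (n : ℚ) - 128) / 448 := by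
  have hN : GepAux.N n n n ≠ 0 := by unfold GepAux.N; positivity
  have hcard : ((W n n n).card : ℚ) = GepAux.N n n n := by
    have := GepAux.moments _ n n n rfl 0 (by norm_num)
    simpa [GepAux.P] using this
  have hsum : ∑ w ∈ W n n n, ((gep w : ℚ) - (n : ℚ) ^ 3 / 2) ^ 6
      = (n / 2 : ℚ) ^ 6 * (GepAux.N n n n * GepAux.P 6 n n n) := by
    rw [← GepAux.moments _ n n n rfl 6 le_rfl, Finset.mul_sum]
    refine Finset.sum_congr rfl fun w hw => ?_
    rw [GepAux.gep_Y n w hw]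
    ring
  rw [hcard, hsum, div_eq_iff hN]
  simp only [GepAux.P, GepAux.P6]
  ring
end

section
/- For every n ≥ 1, the eighth central moment of the Gepner statistic over W(n,n,n) equals n¹¹(3429n⁵ − 16480n⁴ + 32512n³ − 32512n² + 16384n − 3328)/1280; that is, (1/|W(n,n,n)|) Σ_{w ∈ W(n,n,n)} (gep(w) − n³/2)⁸ equals this polynomial expression (as an identity in ℚ). -/
/-! ### Moment polynomials -/

set_option maxHeartbeats 4000000
set_option linter.all false

/-- Numerator of the moment polynomial of order 2, in the elementary symmetric
functions `s`, `p`, `t` of the letter multiplicities; the denominator is 3. -/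
def E2 (s p t : ℚ) : ℚ :=
  (-9) * t
    + (1 + s) * p

/-- Numerator of the moment polynomial of order 4, in the elementary symmetric
functions `s`, `p`, `t` of the letter multiplicities; the denominator is 15. -/
def E4 (s p t : ℚ) : ℚ :=
  (-30 + 36 * s + 66 * s ^ 2) * t
    + 405 * t ^ 2
    + (-2 * s - 4 * s ^ 2 - 2 * s ^ 3) * p
    + (-252 - 90 * s) * p * t
    + (7 + 12 * s + 5 * s ^ 2) * p ^ 2

/-- Numerator of the moment polynomial of order 6, in the elementary symmetric
functions `s`, `p`, `t` of the letter multiplicities; the denominator is 63. -/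
def E6 (s p t : ℚ) : ℚ :=
  (-1080 + 1536 * s + 1624 * s ^ 2 - 2160 * s ^ 3 - 1168 * s ^ 4) * t
    + (3726 - 2916 * s - 12474 * s ^ 2) * t ^ 2
    + (-25515) * t ^ 3
    + (-8 * s + 40 * s ^ 3 + 48 * s ^ 4 + 16 * s ^ 5) * p
    + (-7182 + 6552 * s + 9666 * s ^ 2 + 1764 * s ^ 3) * p * t
    + (39123 + 8505 * s) * p * t ^ 2
    + (-82 * s - 198 * s ^ 2 - 158 * s ^ 3 - 42 * s ^ 4) * p ^ 2
    + (-16389 - 5670 * s - 945 * s ^ 2) * p ^ 2 * t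
    + (93 + 205 * s + 147 * s ^ 2 + 35 * s ^ 3) * p ^ 3

/-- Numerator of the moment polynomial of order 8, in the elementary symmetric
functions `s`, `p`, `t` of the letter multiplicities; the denominator is 135. -/
def E8 (s p t : ℚ) : ℚ :=
  (-88992 + 147456 * s + 76464 * s ^ 2 - 215040 * s ^ 3 + 3744 * s ^ 4 + 77376 * s ^ 5 + 18576 * s ^ 6) * t
    + (-63180 + 147312 * s - 416520 * s ^ 2 + 304560 * s ^ 3 + 301716 * s ^ 4) * t ^ 2
    + (154548 - 87480 * s + 1122660 * s ^ 2) * t ^ 3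
    + 1148175 * t ^ 4
    + (-96 * s + 336 * s ^ 3 - 672 * s ^ 5 - 576 * s ^ 6 - 144 * s ^ 7) * p
    + (-526608 + 750360 * s + 359648 * s ^ 2 - 533104 * s ^ 3 - 277424 * s ^ 4 - 31784 * s ^ 5) * p * t
    + (996624 - 867996 * s - 2043144 * s ^ 2 - 283500 * s ^ 3) * p * t ^ 2
    + (-3265920 - 510300 * s) * p * t ^ 3
    + (-496 * s - 76 * s ^ 2 + 2480 * s ^ 3 + 3704 * s ^ 4 + 2048 * s ^ 5 + 404 * s ^ 6) * p ^ 2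
    + (-1205172 + 927864 * s + 1070136 * s ^ 2 + 218232 * s ^ 3 + 21420 * s ^ 4) * p ^ 2 * t
    + (3382074 + 816480 * s + 85050 * s ^ 2) * p ^ 2 * t ^ 2
    + (-2060 * s - 5576 * s ^ 2 - 5584 * s ^ 3 - 2488 * s ^ 4 - 420 * s ^ 5) * p ^ 3
    + (-1242432 - 351828 * s - 60480 * s ^ 2 - 6300 * s ^ 3) * p ^ 3 * t
    + (1143 + 2912 * s + 2714 * s ^ 2 + 1120 * s ^ 3 + 175 * s ^ 4) * p ^ 4

def E0 (_ _ _ : ℚ) : ℚ := 1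

def A20 (s p t : ℚ) : ℚ :=
  0

def A21 (s p t : ℚ) : ℚ :=
  2 * s ^ 2
    + (-9) * t
    + (-3 + s) * p

def A22 (s p t : ℚ) : ℚ :=
  (-2 * s)

theorem root2 (a u v : ℚ) :
    a * (E2 (a - 1 + u) ((a - 1) * u + v) ((a - 1) * v)
      + 3 * (u ^ 2 - 4 * v) * E0 (a - 1 + u) ((a - 1) * u + v) ((a - 1) * v))
    = A20 (a + u) (a * u + v) (a * v) + A21 (a + u) (a * u + v) (a * v) * a
      + A22 (a + u) (a * u + v) (a * v) * a ^ 2 := by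
  unfold E2 E0 A20 A21 A22
  ring

theorem newton2 (s p t : ℚ) :
    3 * A20 s p t + s * A21 s p t + (s ^ 2 - 2 * p) * A22 s p t = s * E2 s p t := by
  unfold A20 A21 A22 E2
  ring

def A40 (s p t : ℚ) : ℚ :=
  (-64 * s + 104 * s ^ 2) * t
    + (-288) * p * t

def A41 (s p t : ℚ) : ℚ :=
  (-8 * s ^ 4)
    + (162 + 156 * s - 114 * s ^ 2) * t
    + 405 * t ^ 2
    + (-2 * s + 8 * s ^ 2 + 18 * s ^ 3) * p
    + (108 - 90 * s) * p * t
    + (15 - 28 * s + 5 * s ^ 2) * p ^ 2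

def A42 (s p t : ℚ) : ℚ :=
  8 * s ^ 3
    + (-432 + 180 * s) * t
    + (4 * s - 20 * s ^ 2) * p

theorem root4 (a u v : ℚ) :
    a * (E4 (a - 1 + u) ((a - 1) * u + v) ((a - 1) * v)
      + 30 * (u ^ 2 - 4 * v) * E2 (a - 1 + u) ((a - 1) * u + v) ((a - 1) * v)
      + 15 * (u ^ 2 - 4 * v) ^ 2 * E0 (a - 1 + u) ((a - 1) * u + v) ((a - 1) * v))
    = A40 (a + u) (a * u + v) (a * v) + A41 (a + u) (a * u + v) (a * v) * a
      + A42 (a + u) (a * u + v) (a * v) * a ^ 2 := by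
  unfold E4 E2 E0 A40 A41 A42
  ring

theorem newton4 (s p t : ℚ) :
    3 * A40 s p t + s * A41 s p t + (s ^ 2 - 2 * p) * A42 s p t = s * E4 s p t := by
  unfold A40 A41 A42 E4
  ring

def A60 (s p t : ℚ) : ℚ :=
  (-2304 * s + 3072 * s ^ 2 + 1536 * s ^ 3 - 2976 * s ^ 4) * t
    + (22464 * s - 19656 * s ^ 2) * t ^ 2
    + (-7872 * s + 17928 * s ^ 2 + 2184 * s ^ 3) * p * t
    + 54432 * p * t ^ 2
    + (-33696 - 6048 * s) * p ^ 2 * t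

def A61 (s p t : ℚ) : ℚ :=
  96 * s ^ 6
    + (5832 - 7680 * s - 4244 * s ^ 2 - 11592 * s ^ 3 + 3116 * s ^ 4) * t
    + (-63666 - 25596 * s + 4536 * s ^ 2) * t ^ 2
    + (-25515) * t ^ 3
    + (-8 * s - 44 * s ^ 3 - 192 * s ^ 4 - 236 * s ^ 5) * p
    + (18954 + 40032 * s - 2430 * s ^ 2 - 2016 * s ^ 3) * p * t
    + (5103 + 8505 * s) * p * t ^ 2
    + (86 * s - 24 * s ^ 2 + 346 * s ^ 3 + 168 * s ^ 4) * p ^ 2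
    + (-4293 + 1890 * s - 945 * s ^ 2) * p ^ 2 * t
    + (-63 + 205 * s - 273 * s ^ 2 + 35 * s ^ 3) * p ^ 3

def A62 (s p t : ℚ) : ℚ :=
  (-96 * s ^ 5)
    + (1260 * s + 18360 * s ^ 2 - 4284 * s ^ 3) * t
    + (81648 - 17010 * s) * t ^ 2
    + (84 * s ^ 2 + 48 * s ^ 3 + 252 * s ^ 4) * p
    + (-50544 - 3024 * s + 3780 * s ^ 2) * p * t
    + (-78 * s - 210 * s ^ 3) * p ^ 2

theorem root6 (a u v : ℚ) :
    a * (E6 (a - 1 + u) ((a - 1) * u + v) ((a - 1) * v)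
      + 63 * (u ^ 2 - 4 * v) * E4 (a - 1 + u) ((a - 1) * u + v) ((a - 1) * v)
      + 315 * (u ^ 2 - 4 * v) ^ 2 * E2 (a - 1 + u) ((a - 1) * u + v) ((a - 1) * v)
      + 63 * (u ^ 2 - 4 * v) ^ 3 * E0 (a - 1 + u) ((a - 1) * u + v) ((a - 1) * v))
    = A60 (a + u) (a * u + v) (a * v) + A61 (a + u) (a * u + v) (a * v) * a
      + A62 (a + u) (a * u + v) (a * v) * a ^ 2 := by
  unfold E6 E4 E2 E0 A60 A61 A62
  ring

theorem newton6 (s p t : ℚ) :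
    3 * A60 s p t + s * A61 s p t + (s ^ 2 - 2 * p) * A62 s p t = s * E6 s p t := by
  unfold A60 A61 A62 E6
  ring

def A80 (s p t : ℚ) : ℚ :=
  (-239616 * s + 393216 * s ^ 2 - 245760 * s ^ 4 + 36864 * s ^ 5 + 65664 * s ^ 6) * t
    + (145152 * s + 131616 * s ^ 2 - 1297728 * s ^ 3 + 823968 * s ^ 4) * t ^ 2
    + (-2954880 * s + 1769040 * s ^ 2) * t ^ 3
    + (-764928 * s + 960768 * s ^ 2 + 29664 * s ^ 3 - 699840 * s ^ 4 - 68256 * s ^ 5) * p * t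
    + (-1959552 + 4485888 * s - 4525632 * s ^ 2 - 393120 * s ^ 3) * p * t ^ 2
    + (-4898880) * p * t ^ 3
    + (-352512 * s + 2697456 * s ^ 2 + 404928 * s ^ 3 + 21840 * s ^ 4) * p ^ 2 * t
    + (8024832 + 1088640 * s) * p ^ 2 * t ^ 2
    + (-3748032 - 698112 * s - 60480 * s ^ 2) * p ^ 3 * t

def A81 (s p t : ℚ) : ℚ :=
  (-1152 * s ^ 8)
    + (629856 - 1032192 * s + 33264 * s ^ 2 + 583680 * s ^ 3 + 226240 * s ^ 4 + 359424 * s ^ 5 - 67600 * s ^ 6) * t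
    + (-498636 + 2691792 * s + 1800936 * s ^ 2 + 2490480 * s ^ 3 - 333324 * s ^ 4) * t ^ 2
    + (9019188 + 1953720 * s + 102060 * s ^ 2) * t ^ 3
    + 1148175 * t ^ 4
    + (-96 * s + 16 * s ^ 3 + 1600 * s ^ 5 + 3456 * s ^ 6 + 3088 * s ^ 7) * p
    + (1854576 - 2254824 * s - 1850064 * s ^ 2 - 2421424 * s ^ 3 + 18912 * s ^ 4 + 69016 * s ^ 5) * p * t
    + (-9109584 - 8643996 * s - 69984 * s ^ 2 + 56700 * s ^ 3) * p * t ^ 2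
    + (-1224720 - 510300 * s) * p * t ^ 3
    + (144 * s - 76 * s ^ 2 - 3328 * s ^ 3 - 4072 * s ^ 4 - 6992 * s ^ 5 - 2956 * s ^ 6) * p ^ 2
    + (2761452 + 4517064 * s + 610704 * s ^ 2 - 94248 * s ^ 3 - 16380 * s ^ 4) * p ^ 2 * t
    + (1068714 + 136080 * s + 85050 * s ^ 2) * p ^ 2 * t ^ 2
    + (468 * s + 3568 * s ^ 2 + 1432 * s ^ 3 + 5072 * s ^ 4 + 980 * s ^ 5) * p ^ 3
    + (-335664 - 79668 * s + 15120 * s ^ 2 - 6300 * s ^ 3) * p ^ 3 * t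
    + (135 - 816 * s + 1034 * s ^ 2 - 1680 * s ^ 3 + 175 * s ^ 4) * p ^ 4

def A82 (s p t : ℚ) : ℚ :=
  1152 * s ^ 7
    + (43200 * s - 61440 * s ^ 2 - 333088 * s ^ 3 - 479040 * s ^ 4 + 86176 * s ^ 5) * t
    + (-2939328 + 1675728 * s - 4657824 * s ^ 2 + 635040 * s ^ 3) * t ^ 2
    + (-7348320 + 1020600 * s) * t ^ 3
    + (320 * s ^ 2 - 2272 * s ^ 4 - 1728 * s ^ 5 - 3232 * s ^ 6) * p
    + (1454544 * s + 3029760 * s ^ 2 + 80784 * s ^ 3 - 100800 * s ^ 4) * p * t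
    + (12037248 + 476280 * s - 340200 * s ^ 2) * p * t ^ 2
    + (1264 * s ^ 2 + 4320 * s ^ 3 + 2576 * s ^ 4 + 3360 * s ^ 5) * p ^ 2
    + (-5622048 - 593784 * s + 45360 * s ^ 2 + 37800 * s ^ 3) * p ^ 2 * t
    + (-504 * s - 1864 * s ^ 2 - 840 * s ^ 3 - 1400 * s ^ 4) * p ^ 3

theorem root8 (a u v : ℚ) :
    a * (E8 (a - 1 + u) ((a - 1) * u + v) ((a - 1) * v)
      + 60 * (u ^ 2 - 4 * v) * E6 (a - 1 + u) ((a - 1) * u + v) ((a - 1) * v)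
      + 630 * (u ^ 2 - 4 * v) ^ 2 * E4 (a - 1 + u) ((a - 1) * u + v) ((a - 1) * v)
      + 1260 * (u ^ 2 - 4 * v) ^ 3 * E2 (a - 1 + u) ((a - 1) * u + v) ((a - 1) * v)
      + 135 * (u ^ 2 - 4 * v) ^ 4 * E0 (a - 1 + u) ((a - 1) * u + v) ((a - 1) * v))
    = A80 (a + u) (a * u + v) (a * v) + A81 (a + u) (a * u + v) (a * v) * a
      + A82 (a + u) (a * u + v) (a * v) * a ^ 2 := by
  unfold E8 E6 E4 E2 E0 A80 A81 A82
  ring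

theorem newton8 (s p t : ℚ) :
    3 * A80 s p t + s * A81 s p t + (s ^ 2 - 2 * p) * A82 s p t = s * E8 s p t := by
  unfold A80 A81 A82 E8
  ring

/-! ### Combinatorial part -/

/-- The cyclic inversion statistic. -/
def cyc : List ℕ → ℚ
  | [] => 0
  | x :: w => cyc w + (if x = 1 then (w.count 2 : ℚ) - w.count 3
      else if x = 2 then (w.count 3 : ℚ) - w.count 1
      else if x = 3 then (w.count 1 : ℚ) - w.count 2 else 0)

/-- Number of pairs of positions `j < k` with `w_j = p` and `w_k = q`. -/
def pairs (p q : ℕ) : List ℕ → ℕ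
  | [] => 0
  | x :: w => (if x = p then w.count q else 0) + pairs p q w

theorem count_eq_sum (q : ℕ) (w : List ℕ) :
    w.count q = ∑ k : Fin w.length, if w.get k = q then 1 else 0 := by
  induction w with
  | nil => simp
  | cons x w ih =>
    rw [List.count_cons, ih]
    simp only [List.length_cons]
    rw [Fin.sum_univ_succ, add_comm]
    simp only [beq_iff_eq]
    rfl

theorem pairs_eq_sum (p q : ℕ) (w : List ℕ) :
    pairs p q w = ∑ j : Fin w.length, ∑ k : Fin w.length,
      if j < k ∧ w.get j = p ∧ w.get k = q then 1 else 0 := by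
  induction w with
  | nil => simp [pairs]
  | cons x w ih =>
    rw [pairs, ih, count_eq_sum]
    simp only [List.length_cons]
    simp only [Fin.sum_univ_succ]
    by_cases h : x = p <;> simp [h]

theorem gep_eq_sum (w : List ℕ) :
    gep w = ∑ i : Fin w.length, ∑ j : Fin w.length, ∑ k : Fin w.length,
      if i < j ∧ j < k ∧
      ((w.get i < w.get k ∧ w.get k < w.get j) ∨
       (w.get j < w.get i ∧ w.get i < w.get k) ∨
       (w.get k < w.get j ∧ w.get j < w.get i)) then 1 else 0 := by
  unfold gep
  rw [Finset.card_filter, Fintype.sum_prod_type]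
  simp only [Fintype.sum_prod_type]

theorem gep_cons (x : ℕ) (w : List ℕ) :
    gep (x :: w) = (∑ j : Fin w.length, ∑ k : Fin w.length,
      if j < k ∧ ((x < w.get k ∧ w.get k < w.get j) ∨
       (w.get j < x ∧ x < w.get k) ∨
       (w.get k < w.get j ∧ w.get j < x)) then 1 else 0) + gep w := by
  rw [gep_eq_sum, gep_eq_sum]
  simp only [List.length_cons]
  simp only [Fin.sum_univ_succ]
  simp

theorem gep_cons' (x p q : ℕ) (w : List ℕ) (hw : ∀ y ∈ w, y = 1 ∨ y = 2 ∨ y = 3)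
    (h : (x = 1 ∧ p = 3 ∧ q = 2) ∨ (x = 2 ∧ p = 1 ∧ q = 3) ∨ (x = 3 ∧ p = 2 ∧ q = 1)) :
    gep (x :: w) = pairs p q w + gep w := by
  rw [gep_cons, pairs_eq_sum]
  congr 1
  refine Finset.sum_congr rfl fun j _ => Finset.sum_congr rfl fun k _ => ?_
  have h1 := hw _ (List.get_mem w j)
  have h2 := hw _ (List.get_mem w k)
  generalize w.get j = y at *
  generalize w.get k = z at *
  congr 1
  apply propext
  omega

theorem pairs_add (p q : ℕ) (hpq : p ≠ q) (w : List ℕ) :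
    pairs p q w + pairs q p w = w.count p * w.count q := by
  induction w with
  | nil => simp [pairs]
  | cons x w ih =>
    simp only [pairs, List.count_cons, beq_iff_eq]
    by_cases h : x = p
    · subst h
      simp [hpq]
      linarith
    · by_cases h' : x = q
      · subst h'
        simp [h]
        linarith
      · simp [h, h']
        linarith

theorem cyc_eq_pairs (w : List ℕ) (hw : ∀ y ∈ w, y = 1 ∨ y = 2 ∨ y = 3) :
    cyc w = ((pairs 1 2 w : ℚ) - pairs 2 1 w) + ((pairs 2 3 w : ℚ) - pairs 3 2 w)
      + ((pairs 3 1 w : ℚ) - pairs 1 3 w) := by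
  induction w with
  | nil => simp [pairs, cyc]
  | cons x w ih =>
    have hx := hw x (by simp)
    rw [cyc, ih fun y hy => hw y (by simp [hy])]
    rcases hx with rfl | rfl | rfl <;> simp [pairs] <;> ring

theorem two_gep (w : List ℕ) (hw : ∀ y ∈ w, y = 1 ∨ y = 2 ∨ y = 3) :
    2 * (gep w : ℚ) = (w.count 1 : ℚ) * w.count 2 * w.count 3
      - (w.count 3 * ((pairs 1 2 w : ℚ) - pairs 2 1 w)
        + w.count 1 * ((pairs 2 3 w : ℚ) - pairs 3 2 w)
        + w.count 2 * ((pairs 3 1 w : ℚ) - pairs 1 3 w)) := by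
  induction w with
  | nil => simp [pairs, gep]
  | cons x w ih =>
    have hx := hw x (by simp)
    have hw' : ∀ y ∈ w, y = 1 ∨ y = 2 ∨ y = 3 := fun y hy => hw y (by simp [hy])
    have ih := ih hw'
    have p12 : ((pairs 1 2 w : ℚ) + pairs 2 1 w) = w.count 1 * w.count 2 := by
      exact_mod_cast pairs_add 1 2 (by norm_num) w
    have p23 : ((pairs 2 3 w : ℚ) + pairs 3 2 w) = w.count 2 * w.count 3 := by
      exact_mod_cast pairs_add 2 3 (by norm_num) w
    have p31 : ((pairs 3 1 w : ℚ) + pairs 1 3 w) = w.count 3 * w.count 1 := by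
      exact_mod_cast pairs_add 3 1 (by norm_num) w
    rcases hx with rfl | rfl | rfl
    · rw [gep_cons' 1 3 2 w hw' (by simp)]
      simp [pairs]
      linear_combination ih + p23
    · rw [gep_cons' 2 1 3 w hw' (by simp)]
      simp [pairs]
      linear_combination ih + p31
    · rw [gep_cons' 3 2 1 w hw' (by simp)]
      simp [pairs]
      linear_combination ih + p12

theorem cyc_append (w v : List ℕ) :
    cyc (w ++ v) = cyc w + cyc v
      + ((w.count 1 : ℚ) * ((v.count 2 : ℚ) - v.count 3)
        + (w.count 2 : ℚ) * ((v.count 3 : ℚ) - v.count 1)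
        + (w.count 3 : ℚ) * ((v.count 1 : ℚ) - v.count 2)) := by
  induction w with
  | nil => simp [cyc]
  | cons x w ih =>
    rw [List.cons_append, cyc, cyc, ih]
    by_cases h1 : x = 1
    · subst h1; simp; ring
    by_cases h2 : x = 2
    · subst h2; simp; ring
    by_cases h3 : x = 3
    · subst h3; simp; ring
    simp [h1, h2, h3]

theorem cyc_reverse (w : List ℕ) : cyc w.reverse = - cyc w := by
  induction w with
  | nil => simp [cyc]
  | cons x w ih =>
    rw [List.reverse_cons, cyc_append, ih]
    by_cases h1 : x = 1
    · subst h1; simp [cyc]; ring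
    by_cases h2 : x = 2
    · subst h2; simp [cyc]; ring
    by_cases h3 : x = 3
    · subst h3; simp [cyc]; ring
    simp [h1, h2, h3, cyc]

/-! ### The sets `W` -/

theorem mem_W {a b c : ℕ} {w : List ℕ} : w ∈ W a b c ↔
    (∀ y ∈ w, y = 1 ∨ y = 2 ∨ y = 3) ∧ w.count 1 = a ∧ w.count 2 = b ∧ w.count 3 = c := by
  unfold W
  rw [List.mem_toFinset, List.mem_permutations]
  constructor
  · intro h
    refine ⟨fun y hy => ?_, ?_, ?_, ?_⟩
    · have := h.mem_iff.1 hy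
      simp only [List.mem_append, List.mem_replicate] at this
      omega
    all_goals
      rw [h.count_eq]
      simp [List.count_replicate]
  · rintro ⟨h, h1, h2, h3⟩
    rw [List.perm_iff_count]
    intro y
    by_cases hy : y ∈ w
    · rcases h y hy with rfl | rfl | rfl <;> simp [List.count_replicate, *]
    · rw [List.count_eq_zero_of_not_mem hy]
      symm
      rw [List.count_eq_zero]
      simp only [List.mem_append, List.mem_replicate]
      rintro ((⟨ha, rfl⟩ | ⟨ha, rfl⟩) | ⟨ha, rfl⟩)
      all_goals
        rw [List.count_eq_zero_of_not_mem hy] at *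
        omega

/-- Sum over `W`. -/
def Msum (r a b c : ℕ) : ℚ := ∑ w ∈ W a b c, cyc w ^ r

theorem Msum_odd (r a b c : ℕ) (hr : Odd r) : Msum r a b c = 0 := by
  have h : Msum r a b c = - Msum r a b c := by
    conv_lhs => unfold Msum
    unfold Msum
    rw [← Finset.sum_neg_distrib]
    refine Finset.sum_bij' (fun w _ => w.reverse) (fun w _ => w.reverse) ?_ ?_ ?_ ?_ ?_
    · intro w hw
      simpa [mem_W] using hw
    · intro w hw
      simpa [mem_W] using hw
    · simp
    · simp
    · intro w hw
      rw [cyc_reverse, hr.neg_pow, neg_neg]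
  linarith

/-- Words in `W a b c` whose first letter is `x`, summed. -/
def headSum (f : List ℕ → ℚ) (x a b c : ℕ) : ℚ :=
  ∑ w ∈ (W a b c).filter (fun w => w.head? = some x), f w

theorem sum_split (f : List ℕ → ℚ) (a b c : ℕ) (h : 0 < a + b + c) :
    ∑ w ∈ W a b c, f w = headSum f 1 a b c + headSum f 2 a b c + headSum f 3 a b c := by
  unfold headSum
  simp only [Finset.sum_filter]
  rw [← Finset.sum_add_distrib, ← Finset.sum_add_distrib]
  refine Finset.sum_congr rfl fun w hw => ?_
  rw [mem_W] at hw
  cases w with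
  | nil => simp at hw; omega
  | cons x w =>
    rcases hw.1 x (by simp) with rfl | rfl | rfl <;> simp

theorem headSum_zero (f : List ℕ → ℚ) (x a b c : ℕ)
    (h : (x = 1 ∧ a = 0) ∨ (x = 2 ∧ b = 0) ∨ (x = 3 ∧ c = 0)) : headSum f x a b c = 0 := by
  unfold headSum
  rw [Finset.filter_eq_empty_iff.2, Finset.sum_empty]
  intro w hw hx
  rw [mem_W] at hw
  cases w with
  | nil => simp at hx
  | cons y w =>
    simp at hx
    subst hx
    rcases h with ⟨rfl, rfl⟩ | ⟨rfl, rfl⟩ | ⟨rfl, rfl⟩ <;> simp at hw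

theorem headSum_succ (f : List ℕ → ℚ) (x a b c a' b' c' : ℕ)
    (h : (x = 1 ∧ a' = a + 1 ∧ b' = b ∧ c' = c) ∨ (x = 2 ∧ a' = a ∧ b' = b + 1 ∧ c' = c) ∨
      (x = 3 ∧ a' = a ∧ b' = b ∧ c' = c + 1)) :
    headSum f x a' b' c' = ∑ w ∈ W a b c, f (x :: w) := by
  unfold headSum
  symm
  refine Finset.sum_bij' (fun w _ => x :: w) (fun w _ => w.tail) ?_ ?_ ?_ ?_ ?_
  · intro w hw
    rw [Finset.mem_filter, mem_W]
    rw [mem_W] at hw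
    obtain ⟨h0, h1, h2, h3⟩ := hw
    rcases h with ⟨rfl, rfl, rfl, rfl⟩ | ⟨rfl, rfl, rfl, rfl⟩ | ⟨rfl, rfl, rfl, rfl⟩ <;>
      simp [h1, h2, h3] <;> exact h0
  · intro w hw
    rw [Finset.mem_filter, mem_W] at hw
    rw [mem_W]
    obtain ⟨⟨h0, h1, h2, h3⟩, h4⟩ := hw
    cases w with
    | nil => simp at h4
    | cons y w =>
      simp at h4
      subst h4
      refine ⟨fun z hz => h0 z (by simpa using Or.inr hz), ?_⟩
      rcases h with ⟨rfl, rfl, rfl, rfl⟩ | ⟨rfl, rfl, rfl, rfl⟩ | ⟨rfl, rfl, rfl, rfl⟩ <;>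
        simp at h1 h2 h3 <;> simp [h1, h2, h3]
  · simp
  · intro w hw
    rw [Finset.mem_filter] at hw
    cases w with
    | nil => simp at hw
    | cons y w => simp at hw; simp [hw.2]
  · simp

/-- Multinomial coefficient. -/
def mult (a b c : ℕ) : ℚ :=
  ((a + b + c).factorial : ℚ) / (a.factorial * b.factorial * c.factorial)

theorem mult_pos (a b c : ℕ) : 0 < mult a b c := by
  unfold mult
  positivity

theorem mult_succ1 (a b c : ℕ) :
    ((a : ℚ) + 1 + b + c) * mult a b c = mult (a + 1) b c * (a + 1) := by
  unfold mult
  rw [show a + 1 + b + c = (a + b + c) + 1 by ring, Nat.factorial_succ, Nat.factorial_succ]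
  push_cast
  field_simp
  ring

theorem mult_succ2 (a b c : ℕ) :
    ((a : ℚ) + (b + 1) + c) * mult a b c = mult a (b + 1) c * (b + 1) := by
  unfold mult
  rw [show a + (b + 1) + c = (a + b + c) + 1 by ring, Nat.factorial_succ, Nat.factorial_succ]
  push_cast
  field_simp
  ring

theorem mult_succ3 (a b c : ℕ) :
    ((a : ℚ) + b + (c + 1)) * mult a b c = mult a b (c + 1) * (c + 1) := by
  unfold mult
  rw [show a + b + (c + 1) = (a + b + c) + 1 by ring, Nat.factorial_succ, Nat.factorial_succ]
  push_cast
  field_simp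
  ring

/-- Numerators of the moments. -/
def Hyp (a b c : ℕ) : Prop :=
  Msum 0 a b c = mult a b c ∧
  3 * Msum 2 a b c = mult a b c * E2 (a + b + c) (a * b + b * c + c * a) (a * b * c) ∧
  15 * Msum 4 a b c = mult a b c * E4 (a + b + c) (a * b + b * c + c * a) (a * b * c) ∧
  63 * Msum 6 a b c = mult a b c * E6 (a + b + c) (a * b + b * c + c * a) (a * b * c) ∧
  135 * Msum 8 a b c = mult a b c * E8 (a + b + c) (a * b + b * c + c * a) (a * b * c)

/-- Binomial expansion of the shifted moments (odd moments vanish). -/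
theorem shift_expand (a b c : ℕ) (d : ℚ) :
    (∑ w ∈ W a b c, (cyc w + d) ^ 2 = Msum 2 a b c + d ^ 2 * Msum 0 a b c) ∧
    (∑ w ∈ W a b c, (cyc w + d) ^ 4 = Msum 4 a b c + 6 * d ^ 2 * Msum 2 a b c
      + d ^ 4 * Msum 0 a b c) ∧
    (∑ w ∈ W a b c, (cyc w + d) ^ 6 = Msum 6 a b c + 15 * d ^ 2 * Msum 4 a b c
      + 15 * d ^ 4 * Msum 2 a b c + d ^ 6 * Msum 0 a b c) ∧
    (∑ w ∈ W a b c, (cyc w + d) ^ 8 = Msum 8 a b c + 28 * d ^ 2 * Msum 6 a b c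
      + 70 * d ^ 4 * Msum 4 a b c + 28 * d ^ 6 * Msum 2 a b c + d ^ 8 * Msum 0 a b c) := by
  have o1 := Msum_odd 1 a b c (by decide)
  have o3 := Msum_odd 3 a b c (by decide)
  have o5 := Msum_odd 5 a b c (by decide)
  have o7 := Msum_odd 7 a b c (by decide)
  have key : ∀ r, ∑ w ∈ W a b c, (cyc w + d) ^ r
      = ∑ k ∈ Finset.range (r + 1), Msum k a b c * d ^ (r - k) * (r.choose k) := by
    intro r
    simp only [add_pow, Msum, Finset.sum_mul]
    rw [Finset.sum_comm]
  refine ⟨?_, ?_, ?_, ?_⟩ <;> rw [key] <;>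
    simp only [Finset.sum_range_succ, Finset.sum_range_zero, o1, o3, o5, o7] <;>
    norm_num [Nat.choose] <;> ring

/-- The generic one-letter contributions, indexed by multiplicity of the removed letter and
the symmetric functions of the two others. -/
def Contrib (f : ℕ → ℚ) (N g a u v : ℚ) : Prop :=
  N * f 0 = g * a ∧
  3 * (N * f 2) = g * (A20 (a + u) (a * u + v) (a * v) + A21 (a + u) (a * u + v) (a * v) * a
      + A22 (a + u) (a * u + v) (a * v) * a ^ 2) ∧
  15 * (N * f 4) = g * (A40 (a + u) (a * u + v) (a * v) + A41 (a + u) (a * u + v) (a * v) * a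
      + A42 (a + u) (a * u + v) (a * v) * a ^ 2) ∧
  63 * (N * f 6) = g * (A60 (a + u) (a * u + v) (a * v) + A61 (a + u) (a * u + v) (a * v) * a
      + A62 (a + u) (a * u + v) (a * v) * a ^ 2) ∧
  135 * (N * f 8) = g * (A80 (a + u) (a * u + v) (a * v) + A81 (a + u) (a * u + v) (a * v) * a
      + A82 (a + u) (a * u + v) (a * v) * a ^ 2)

theorem contrib_zero (N g u v : ℚ) (f : ℕ → ℚ) (hf : ∀ r, f r = 0) : Contrib f N g 0 u v := by
  refine ⟨by simp [hf], ?_, ?_, ?_, ?_⟩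
  · rw [← root2, hf]; simp
  · rw [← root4, hf]; simp
  · rw [← root6, hf]; simp
  · rw [← root8, hf]; simp

theorem contrib_pos (a b c : ℕ) (H : Hyp a b c) (d N g x u v : ℚ) (f : ℕ → ℚ)
    (hf : ∀ r, f r = ∑ w ∈ W a b c, (cyc w + d) ^ r)
    (hd : d ^ 2 = u ^ 2 - 4 * v) (hg : N * mult a b c = g * x)
    (hs : (a + b + c : ℚ) = x - 1 + u) (hp : (a * b + b * c + c * a : ℚ) = (x - 1) * u + v)
    (ht : (a * b * c : ℚ) = (x - 1) * v) : Contrib f N g x u v := by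
  obtain ⟨H0, H2, H4, H6, H8⟩ := H
  rw [hs, hp, ht] at H2 H4 H6 H8
  obtain ⟨S2, S4, S6, S8⟩ := shift_expand a b c d
  have d4 : d ^ 4 = (u ^ 2 - 4 * v) ^ 2 := by rw [← hd]; ring
  have d6 : d ^ 6 = (u ^ 2 - 4 * v) ^ 3 := by rw [← hd]; ring
  have d8 : d ^ 8 = (u ^ 2 - 4 * v) ^ 4 := by rw [← hd]; ring
  rw [hd] at S2 S4 S6 S8
  rw [d4] at S4 S6 S8
  rw [d6] at S6 S8
  rw [d8] at S8
  have f0 : f 0 = Msum 0 a b c := by rw [hf]; simp [Msum]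
  refine ⟨by rw [f0, H0, hg], ?_, ?_, ?_, ?_⟩
  · rw [← root2, hf, S2]
    generalize E2 (x - 1 + u) ((x - 1) * u + v) ((x - 1) * v) = e2 at *
    generalize u ^ 2 - 4 * v = D at *
    simp only [E0]
    linear_combination N * H2 + 3 * N * D * H0 + (e2 + 3 * D) * hg
  · rw [← root4, hf, S4]
    generalize E2 (x - 1 + u) ((x - 1) * u + v) ((x - 1) * v) = e2 at *
    generalize E4 (x - 1 + u) ((x - 1) * u + v) ((x - 1) * v) = e4 at *
    generalize u ^ 2 - 4 * v = D at *
    simp only [E0]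
    linear_combination N * H4 + 30 * D * N * H2 + 15 * N * D ^ 2 * H0
      + (e4 + 30 * D * e2 + 15 * D ^ 2) * hg
  · rw [← root6, hf, S6]
    generalize E2 (x - 1 + u) ((x - 1) * u + v) ((x - 1) * v) = e2 at *
    generalize E4 (x - 1 + u) ((x - 1) * u + v) ((x - 1) * v) = e4 at *
    generalize E6 (x - 1 + u) ((x - 1) * u + v) ((x - 1) * v) = e6 at *
    generalize u ^ 2 - 4 * v = D at *
    simp only [E0]
    linear_combination N * H6 + 63 * D * N * H4 + 315 * D ^ 2 * N * H2 + 63 * N * D ^ 3 * H0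
      + (e6 + 63 * D * e4 + 315 * D ^ 2 * e2 + 63 * D ^ 3) * hg
  · rw [← root8, hf, S8]
    generalize E2 (x - 1 + u) ((x - 1) * u + v) ((x - 1) * v) = e2 at *
    generalize E4 (x - 1 + u) ((x - 1) * u + v) ((x - 1) * v) = e4 at *
    generalize E6 (x - 1 + u) ((x - 1) * u + v) ((x - 1) * v) = e6 at *
    generalize E8 (x - 1 + u) ((x - 1) * u + v) ((x - 1) * v) = e8 at *
    generalize u ^ 2 - 4 * v = D at *
    simp only [E0]
    linear_combination N * H8 + 60 * D * N * H6 + 630 * D ^ 2 * N * H4 + 1260 * D ^ 3 * N * H2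
      + 135 * N * D ^ 4 * H0
      + (e8 + 60 * D * e6 + 630 * D ^ 2 * e4 + 1260 * D ^ 3 * e2 + 135 * D ^ 4) * hg

theorem contrib1 (a b c : ℕ) (ih : ∀ a', a = a' + 1 → Hyp a' b c) :
    Contrib (fun r => headSum (fun w => cyc w ^ r) 1 a b c) (a + b + c) (mult a b c)
      a (b + c) (b * c) := by
  cases a with
  | zero =>
    rw [Nat.cast_zero]
    exact contrib_zero _ _ _ _ _ fun r => headSum_zero _ _ _ _ _ (by simp)
  | succ a =>
    refine contrib_pos a b c (ih a rfl) (b - c) _ _ _ _ _ _ (fun r => ?_) (by ring) ?_ ?_ ?_ ?_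
    · beta_reduce
      rw [headSum_succ _ 1 a b c _ _ _ (by simp)]
      refine Finset.sum_congr rfl fun w hw => ?_
      rw [mem_W] at hw
      simp [cyc, hw.2]
    · push_cast; rw [← mult_succ1 a b c]
    all_goals (push_cast; ring)

theorem contrib2 (a b c : ℕ) (ih : ∀ b', b = b' + 1 → Hyp a b' c) :
    Contrib (fun r => headSum (fun w => cyc w ^ r) 2 a b c) (a + b + c) (mult a b c)
      b (a + c) (a * c) := by
  cases b with
  | zero =>
    rw [Nat.cast_zero]
    exact contrib_zero _ _ _ _ _ fun r => headSum_zero _ _ _ _ _ (by simp)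
  | succ b =>
    refine contrib_pos a b c (ih b rfl) (c - a) _ _ _ _ _ _ (fun r => ?_) (by ring) ?_ ?_ ?_ ?_
    · beta_reduce
      rw [headSum_succ _ 2 a b c _ _ _ (by simp)]
      refine Finset.sum_congr rfl fun w hw => ?_
      rw [mem_W] at hw
      simp [cyc, hw.2]
    · push_cast; rw [← mult_succ2 a b c]
    all_goals (push_cast; ring)

theorem contrib3 (a b c : ℕ) (ih : ∀ c', c = c' + 1 → Hyp a b c') :
    Contrib (fun r => headSum (fun w => cyc w ^ r) 3 a b c) (a + b + c) (mult a b c)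
      c (a + b) (a * b) := by
  cases c with
  | zero =>
    rw [Nat.cast_zero]
    exact contrib_zero _ _ _ _ _ fun r => headSum_zero _ _ _ _ _ (by simp)
  | succ c =>
    refine contrib_pos a b c (ih c rfl) (a - b) _ _ _ _ _ _ (fun r => ?_) (by ring) ?_ ?_ ?_ ?_
    · beta_reduce
      rw [headSum_succ _ 3 a b c _ _ _ (by simp)]
      refine Finset.sum_congr rfl fun w hw => ?_
      rw [mem_W] at hw
      simp [cyc, hw.2]
    · push_cast; rw [← mult_succ3 a b c]
    all_goals (push_cast; ring)

theorem hyp_zero : Hyp 0 0 0 := by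
  have hW : W 0 0 0 = {[]} := by
    unfold W
    simp
  refine ⟨?_, ?_, ?_, ?_, ?_⟩ <;>
    simp [Msum, hW, mult, cyc, E2, E4, E6, E8]

theorem combine (L N g x1 x2 x3 a b c s p A B C E : ℚ) (hN : N ≠ 0) (hsN : s = N)
    (hs : s = a + b + c) (hp : p = a * b + b * c + c * a)
    (h1 : L * (N * x1) = g * (A + B * a + C * a ^ 2))
    (h2 : L * (N * x2) = g * (A + B * b + C * b ^ 2))
    (h3 : L * (N * x3) = g * (A + B * c + C * c ^ 2))
    (hn : 3 * A + s * B + (s ^ 2 - 2 * p) * C = s * E) :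
    L * (x1 + x2 + x3) = g * E := by
  apply mul_left_cancel₀ hN
  subst hsN
  have hq : s ^ 2 - 2 * p = a ^ 2 + b ^ 2 + c ^ 2 := by rw [hs, hp]; ring
  rw [hq] at hn
  linear_combination h1 + h2 + h3 + g * hn - g * B * hs

theorem hyp_all (n : ℕ) : ∀ a b c : ℕ, a + b + c = n → Hyp a b c := by
  induction n with
  | zero =>
    intro a b c h
    obtain ⟨rfl, rfl, rfl⟩ : a = 0 ∧ b = 0 ∧ c = 0 := by omega
    exact hyp_zero
  | succ n ih =>
    intro a b c h
    have hN : ((a : ℚ) + b + c) ≠ 0 := by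
      have : ((a + b + c : ℕ) : ℚ) ≠ 0 := by rw [h]; positivity
      simpa using this
    obtain ⟨a0, a2, a4, a6, a8⟩ := contrib1 a b c fun a' ha => ih _ _ _ (by omega)
    obtain ⟨b0, b2, b4, b6, b8⟩ := contrib2 a b c fun a' ha => ih _ _ _ (by omega)
    obtain ⟨c0, c2, c4, c6, c8⟩ := contrib3 a b c fun a' ha => ih _ _ _ (by omega)
    have sp : ∀ r, Msum r a b c = headSum (fun w => cyc w ^ r) 1 a b c
        + headSum (fun w => cyc w ^ r) 2 a b c + headSum (fun w => cyc w ^ r) 3 a b c :=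
      fun r => sum_split _ a b c (by omega)
    have s1 : (a : ℚ) + (b + c) = a + b + c := by ring
    have p1 : (a : ℚ) * (b + c) + b * c = a * b + b * c + c * a := by ring
    have t1 : (a : ℚ) * (b * c) = a * b * c := by ring
    have s2 : (b : ℚ) + (a + c) = a + b + c := by ring
    have p2 : (b : ℚ) * (a + c) + a * c = a * b + b * c + c * a := by ring
    have t2 : (b : ℚ) * (a * c) = a * b * c := by ring
    have s3 : (c : ℚ) + (a + b) = a + b + c := by ring
    have p3 : (c : ℚ) * (a + b) + a * b = a * b + b * c + c * a := by ring
    have t3 : (c : ℚ) * (a * b) = a * b * c := by ring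
    rw [s1, p1, t1] at a2 a4 a6 a8
    rw [s2, p2, t2] at b2 b4 b6 b8
    rw [s3, p3, t3] at c2 c4 c6 c8
    refine ⟨?_, ?_, ?_, ?_, ?_⟩
    · rw [sp]
      apply mul_left_cancel₀ hN
      linear_combination a0 + b0 + c0
    · rw [sp]
      exact combine _ _ _ _ _ _ _ _ _ _ _ _ _ _ _ hN rfl rfl rfl a2 b2 c2 (newton2 _ _ _)
    · rw [sp]
      exact combine _ _ _ _ _ _ _ _ _ _ _ _ _ _ _ hN rfl rfl rfl a4 b4 c4 (newton4 _ _ _)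
    · rw [sp]
      exact combine _ _ _ _ _ _ _ _ _ _ _ _ _ _ _ hN rfl rfl rfl a6 b6 c6 (newton6 _ _ _)
    · rw [sp]
      exact combine _ _ _ _ _ _ _ _ _ _ _ _ _ _ _ hN rfl rfl rfl a8 b8 c8 (newton8 _ _ _)

theorem gep_words_eighth_central_moment (n : ℕ) (hn : 1 ≤ n) :
    (∑ w ∈ W n n n, ((gep w : ℚ) - (n : ℚ) ^ 3 / 2) ^ 8) / ((W n n n).card : ℚ) =
      (n : ℚ) ^ 11 * (3429 * (n : ℚ) ^ 5 - 16480 * (n : ℚ) ^ 4 + 32512 * (n : ℚ) ^ 3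
        - 32512 * (n : ℚ) ^ 2 + 16384 * (n : ℚ) - 3328) / 1280 := by
  obtain ⟨H0, -, -, -, H8⟩ := hyp_all _ n n n rfl
  have hcard : ((W n n n).card : ℚ) = mult n n n := by
    rw [← H0]
    simp [Msum]
  have hsum : ∑ w ∈ W n n n, ((gep w : ℚ) - (n : ℚ) ^ 3 / 2) ^ 8
      = (n : ℚ) ^ 8 / 256 * Msum 8 n n n := by
    unfold Msum
    rw [Finset.mul_sum]
    refine Finset.sum_congr rfl fun w hw => ?_
    rw [mem_W] at hw
    obtain ⟨h0, h1, h2, h3⟩ := hw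
    have e1 := two_gep w h0
    have e2 := cyc_eq_pairs w h0
    rw [h1, h2, h3] at e1
    have e3 : (gep w : ℚ) - (n : ℚ) ^ 3 / 2 = - (n / 2) * cyc w := by
      rw [e2]
      linear_combination e1 / 2
    rw [e3]
    ring
  have hm := mult_pos n n n
  rw [hsum, hcard, div_eq_iff hm.ne']
  have h8 : Msum 8 n n n = mult n n n
      * E8 (n + n + n) (n * n + n * n + n * n) (n * n * n) / 135 := by
    linear_combination H8 / 135
  rw [h8]
  unfold E8
  ring
end
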